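/- Let K be a field, R a positively graded finitely generated K-algebra, M a finitely generated graded R-module of dimension d, and r_1, ..., r_d a homogeneous system of parameters for M. Then the period of the Hilbert quasipolynomial Q_M of M divides lcm(deg r_1, ..., deg r_d). -/

import Mathlib

/-- `f` is eventually killed by the `k`-th iterate of the difference operator with step `p`. -/
def EvZ (p : ℤ) : ℕ → (ℤ → ℤ) → Prop
  | 0, f => ∃ N : ℤ, ∀ n, N ≤ n → f n = 0
  | k + 1, f => EvZ p k (fun n => f (n + p) - f n)

theorem EvZ.zero (p : ℤ) (k : ℕ) : EvZ p k (fun _ => 0) := by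
  induction k with
  | zero => exact ⟨0, fun _ _ => rfl⟩
  | succ k ih => simpa [EvZ] using ih

theorem EvZ.add {p : ℤ} {k : ℕ} : ∀ {f g : ℤ → ℤ}, EvZ p k f → EvZ p k g →
    EvZ p k (fun n => f n + g n) := by
  induction k with
  | zero =>
    rintro f g ⟨N, hN⟩ ⟨N', hN'⟩
    exact ⟨max N N', fun n hn => by
      simp [hN n (le_trans (le_max_left _ _) hn), hN' n (le_trans (le_max_right _ _) hn)]⟩
  | succ k ih =>
    intro f g hf hg
    have := ih hf hg
    simp only [EvZ]
    convert this using 2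
    ring

theorem EvZ.neg {p : ℤ} {k : ℕ} : ∀ {f : ℤ → ℤ}, EvZ p k f →
    EvZ p k (fun n => - f n) := by
  induction k with
  | zero =>
    rintro f ⟨N, hN⟩
    exact ⟨N, fun n hn => by simp [hN n hn]⟩
  | succ k ih =>
    intro f hf
    have := ih hf
    simp only [EvZ]
    convert this using 2
    ring

theorem EvZ.shift {p : ℤ} {k : ℕ} (c : ℤ) : ∀ {f : ℤ → ℤ}, EvZ p k f →
    EvZ p k (fun n => f (n + c)) := by
  induction k with
  | zero =>
    rintro f ⟨N, hN⟩
    exact ⟨N - c, fun n hn => hN _ (by linarith)⟩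
  | succ k ih =>
    intro f hf
    have := ih hf
    simp only [EvZ]
    convert this using 4
    ring

theorem EvZ.step {δ q : ℕ} {k : ℕ} {g c : ℤ → ℤ}
    (hc : EvZ ((δ * q : ℕ) : ℤ) k c) (h : ∀ n, g (n + δ) - g n = c n) :
    EvZ ((δ * q : ℕ) : ℤ) (k + 1) g := by
  have key : ∀ j : ℕ, EvZ ((δ * q : ℕ) : ℤ) k (fun n => g (n + ((δ * j : ℕ) : ℤ)) - g n) := by
    intro j
    induction j with
    | zero => simpa using EvZ.zero _ k
    | succ j ih =>
      have := ih.add (hc.shift ((δ * j : ℕ) : ℤ))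
      convert this using 2 with n
      rw [← h]
      push_cast
      rw [show n + (δ : ℤ) * (j + 1) = n + δ * j + δ by ring]
      ring
  exact key q

theorem EvZ.iter {p : ℤ} (hp : 0 ≤ p) {k : ℕ} : ∀ {f : ℤ → ℤ}, EvZ p k f →
    ∃ N : ℤ, ∀ n, N ≤ n → ∀ j, k ≤ j → (fwdDiff p)^[j] f n = 0 := by
  induction k with
  | zero =>
    rintro f ⟨N, hN⟩
    refine ⟨N, fun n hn j _ => ?_⟩
    rw [fwdDiff_iter_eq_sum_shift]
    refine Finset.sum_eq_zero fun i _ => ?_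
    rw [hN, smul_zero]
    have : 0 ≤ i • p := nsmul_nonneg hp i
    linarith
  | succ k ih =>
    intro f hf
    obtain ⟨N, hN⟩ := ih hf
    refine ⟨N, fun n hn j hj => ?_⟩
    obtain ⟨j, rfl⟩ : ∃ i, j = i + 1 := ⟨j - 1, by omega⟩
    exact hN n hn j (by omega)

open Polynomial in
theorem EvZ.poly {p : ℕ} {k : ℕ} {f : ℤ → ℤ} (hf : EvZ p k f) (hp : 0 < p) (c : ℤ) :
    ∃ F : ℂ[X], ∃ m₀ : ℕ, ∀ m : ℕ, m₀ ≤ m → (f (c + p * m) : ℂ) = F.eval (m : ℂ) := by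
  obtain ⟨N, hN⟩ := hf.iter (by positivity)
  obtain ⟨m₀, hm₀⟩ : ∃ m₀ : ℕ, N ≤ c + p * m₀ := by
    refine ⟨(N - c).toNat, ?_⟩
    have h1 : N - c ≤ ((N - c).toNat : ℤ) := Int.self_le_toNat _
    have h2 : (1 : ℤ) ≤ p := by exact_mod_cast hp
    nlinarith
  refine ⟨(∑ i ∈ Finset.range k, C (((fwdDiff (p : ℤ))^[i] f (c + p * m₀) : ℤ) : ℂ) *
    (C ((i.factorial : ℂ)⁻¹) * descPochhammer ℂ i)).comp (X - C (m₀ : ℂ)), m₀, fun m hm => ?_⟩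
  obtain ⟨t, rfl⟩ := Nat.exists_eq_add_of_le hm
  have := shift_eq_sum_fwdDiff_iter (p : ℤ) f t (c + p * m₀)
  rw [show c + (p : ℤ) * ((m₀ + t : ℕ) : ℤ) = c + p * m₀ + t • (p : ℤ) by
    push_cast; simp; ring, this]
  have e : ∑ i ∈ Finset.range (t + 1), t.choose i • (fwdDiff (p : ℤ))^[i] f (c + p * m₀)
      = ∑ i ∈ Finset.range k, t.choose i • (fwdDiff (p : ℤ))^[i] f (c + p * m₀) := by
    rcases le_total (t + 1) k with h | h
    · refine Finset.sum_subset (Finset.range_mono h) fun i _ hi => ?_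
      rw [Nat.choose_eq_zero_of_lt (by simpa using hi), zero_smul]
    · refine (Finset.sum_subset (Finset.range_mono h) fun i _ hi => ?_).symm
      rw [hN _ hm₀ i (by simpa using hi), smul_zero]
  rw [e, eval_comp]
  simp only [eval_finsetSum, eval_mul, eval_C, eval_sub, eval_X]
  push_cast
  refine Finset.sum_congr rfl fun i _ => ?_
  rw [add_sub_cancel_left, nsmul_eq_mul]
  push_cast
  rw [Nat.cast_choose_eq_descPochhammer_div ℂ t i]
  field_simp

open Polynomial in
theorem period_of_EvZ {p k : ℕ} {f : ℤ → ℤ} (hf : EvZ p k f) (hp : 0 < p)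
    (u : ℕ) (a : ℕ → ℤ → ℂ) (π : ℕ) (hπ : 0 < π)
    (hper : ∀ i ≤ u, ∀ n : ℤ, a i (n + π) = a i n)
    (hQ : ∃ N : ℤ, ∀ n : ℤ, N ≤ n →
      (f n : ℂ) = ∑ i ∈ Finset.range (u + 1), a i n * (n : ℂ) ^ i) :
    ∀ i ≤ u, ∀ n : ℤ, a i (n + p) = a i n := by
  intro i hi n
  obtain ⟨N, hN⟩ := hQ
  obtain ⟨F, m₀, hF⟩ := hf.poly hp n
  have hperm : ∀ i ≤ u, ∀ (t : ℕ) (n : ℤ), a i (n + t * π) = a i n := by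
    intro i hi t
    induction t with
    | zero => simp
    | succ t ih =>
      intro n
      rw [← ih n, ← hper i hi (n + t * π)]
      congr 1
      push_cast; ring
  set q : ℤ → ℂ[X] := fun c => ∑ i ∈ Finset.range (u + 1), C (a i c) * X ^ i with hq
  have key : ∀ j : ℕ, (q (n + p * j)).comp (C (n : ℂ) + C (p : ℂ) * X) = F := by
    intro j
    apply eq_of_infinite_eval_eq
    have hinj : Function.Injective
        (fun t : ℕ => ((j + π * (t + m₀ + (N - n).toNat) : ℕ) : ℂ)) := by
      intro s t hst
      have hst' := Nat.cast_injective hst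
      have := Nat.eq_of_mul_eq_mul_left hπ (Nat.add_left_cancel hst')
      omega
    refine (Set.infinite_range_of_injective hinj).mono ?_
    rintro _ ⟨t, rfl⟩
    set w := t + m₀ + (N - n).toNat with hw
    have hw1 : w ≤ π * w := Nat.le_mul_of_pos_left _ hπ
    have hle : N ≤ n + p * ((j + π * w : ℕ) : ℤ) := by
      have h1 : N - n ≤ ((N - n).toNat : ℤ) := Int.self_le_toNat _
      have h2 : (j + π * w) ≤ p * (j + π * w) := Nat.le_mul_of_pos_left _ hp
      have h3 : (N - n).toNat ≤ p * (j + π * w) := by omega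
      have h4 : ((N - n).toNat : ℤ) ≤ (p : ℤ) * ((j + π * w : ℕ) : ℤ) := by exact_mod_cast h3
      linarith
    show eval ((j + π * w : ℕ) : ℂ) _ = eval ((j + π * w : ℕ) : ℂ) _
    rw [← hF _ (by omega), hN _ hle, eval_comp]
    simp only [hq, eval_finsetSum, eval_mul, eval_C, eval_pow, eval_X, eval_add]
    refine Finset.sum_congr rfl fun i hi => ?_
    have : a i (n + p * ((j + π * w : ℕ) : ℤ)) = a i (n + p * j) := by
      rw [← hperm i (by simpa [Nat.lt_succ_iff] using hi) (p * w) (n + p * j)]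
      congr 1; push_cast; ring
    rw [this]
    push_cast; ring
  have e : q (n + p) = q n := by
    have h : (q (n + p)).comp (C (n : ℂ) + C (p : ℂ) * X) =
        (q n).comp (C (n : ℂ) + C (p : ℂ) * X) := by
      have h0 := key 0
      have h1 := key 1
      simp only [Nat.cast_zero, Nat.cast_one, mul_zero, mul_one, add_zero] at h0 h1
      rw [h0, h1]
    have hpc : (p : ℂ) ≠ 0 := by exact_mod_cast hp.ne'
    apply Polynomial.funext
    intro x
    have := congrArg (eval ((x - n) / p)) h
    simp only [eval_comp, eval_add, eval_mul, eval_C, eval_X] at this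
    rwa [mul_div_cancel₀ _ hpc, add_sub_cancel] at this
  have hcoef : ∀ c, (q c).coeff i = a i c := by
    intro c
    simp [hq, coeff_C_mul, coeff_X_pow]
    omega
  rw [← hcoef, ← hcoef, e]

theorem min_period_dvd (u : ℕ) (a : ℕ → ℤ → ℂ) (π p : ℕ) (hπ : 0 < π)
    (hper : ∀ i ≤ u, ∀ n : ℤ, a i (n + π) = a i n)
    (hmin : ∀ π' : ℕ, 0 < π' → (∀ i ≤ u, ∀ n : ℤ, a i (n + π') = a i n) → π ≤ π')
    (hp : ∀ i ≤ u, ∀ n : ℤ, a i (n + p) = a i n) : π ∣ p := by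
  have hperm : ∀ i ≤ u, ∀ (t : ℕ) (n : ℤ), a i (n + t * π) = a i n := by
    intro i hi t
    induction t with
    | zero => simp
    | succ t ih =>
      intro n
      rw [← ih n, ← hper i hi (n + t * π)]
      congr 1
      push_cast; ring
  by_contra hnd
  have hpos : 0 < p % π := Nat.pos_of_ne_zero fun h => hnd (Nat.dvd_of_mod_eq_zero h)
  have hlt := Nat.mod_lt p hπ
  refine absurd (hmin (p % π) hpos fun i hi n => ?_) (by omega)
  rw [← hp i hi n, ← hperm i hi (p / π) (n + (p % π : ℕ))]
  congr 1
  have : ((p % π + π * (p / π) : ℕ) : ℤ) = p := by rw [Nat.mod_add_div]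
  rw [← this]; push_cast; ring

set_option linter.unusedSectionVars false

section Graded

variable {K : Type*} [Field K] {R : Type*} [CommRing R] [Algebra K R]
    {M : Type*} [AddCommGroup M] [Module R M] [Module K M] [IsScalarTower K R M]
    (ℳ : ℤ → Submodule K M) [DirectSum.Decomposition ℳ]

/-- Projection to the degree `n` component. -/
noncomputable def gp (n : ℤ) : M →ₗ[K] M :=
  (ℳ n).subtype ∘ₗ DirectSum.component K ℤ (fun i => ℳ i) n ∘ₗ
    (DirectSum.decomposeLinearEquiv ℳ).toLinearMap

theorem gp_apply (n : ℤ) (m : M) : gp ℳ n m = (DirectSum.decompose ℳ m n : M) := rfl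

theorem gp_mem (n : ℤ) (m : M) : gp ℳ n m ∈ ℳ n := (DirectSum.decompose ℳ m n).2

theorem gp_same {n : ℤ} {m : M} (h : m ∈ ℳ n) : gp ℳ n m = m :=
  DirectSum.decompose_of_mem_same ℳ h

theorem gp_ne {n k : ℤ} {m : M} (h : m ∈ ℳ n) (hk : n ≠ k) : gp ℳ k m = 0 :=
  DirectSum.decompose_of_mem_ne ℳ h hk

/-- The set of degrees in which `m` has nonzero component, as a finset. -/
theorem gp_finite (m : M) : ∃ s : Finset ℤ, (∀ n, n ∉ s → gp ℳ n m = 0) ∧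
    ∑ n ∈ s, gp ℳ n m = m := by
  classical
  refine ⟨(DirectSum.decompose ℳ m).support, fun n hn => ?_,
    DirectSum.sum_support_decompose ℳ m⟩
  rw [gp_apply]
  simpa using hn

theorem gp_smul {x : R} {δ : ℕ} (hx : ∀ (j : ℤ), ∀ m ∈ ℳ j, x • m ∈ ℳ ((δ : ℤ) + j))
    (n : ℤ) (m : M) : gp ℳ (n + δ) (x • m) = x • gp ℳ n m := by
  obtain ⟨s, hs, hm⟩ := gp_finite ℳ m
  have h1 : gp ℳ (n + δ) (x • m) = ∑ k ∈ s, gp ℳ (n + δ) (x • gp ℳ k m) := by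
    rw [← map_sum, ← Finset.smul_sum, hm]
  rw [h1]
  by_cases hn : n ∈ s
  · rw [Finset.sum_eq_single_of_mem n hn]
    · apply gp_same
      rw [add_comm]
      exact hx _ _ (gp_mem ℳ _ _)
    · intro k _ hk
      exact gp_ne ℳ (hx _ _ (gp_mem ℳ k m)) (by omega)
  · rw [hs n hn, smul_zero]
    refine Finset.sum_eq_zero fun k hk => gp_ne ℳ (hx _ _ (gp_mem ℳ k m)) ?_
    rintro h
    obtain rfl : k = n := by omega
    exact hn hk

/-- Homogeneous submodule. -/
def Hom' (B : Submodule R M) : Prop := ∀ n, ∀ b ∈ B, gp ℳ n b ∈ B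

/-- Degree `n` part of a submodule. -/
def pc (B : Submodule R M) (n : ℤ) : Submodule K M := B.restrictScalars K ⊓ ℳ n

theorem mem_pc {B : Submodule R M} {n : ℤ} {m : M} : m ∈ pc ℳ B n ↔ m ∈ B ∧ m ∈ ℳ n := Iff.rfl

theorem finrank_map_add {V W : Type*} [AddCommGroup V] [Module K V] [AddCommGroup W] [Module K W]
    (f : V →ₗ[K] W) (U : Submodule K V) [FiniteDimensional K U] :
    Module.finrank K (U.map f) + Module.finrank K (U ⊓ LinearMap.ker f : Submodule K V) =
      Module.finrank K U := by
  have h := LinearMap.finrank_range_add_finrank_ker (f.domRestrict U)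
  have h1 : LinearMap.range (f.domRestrict U) = U.map f := by
    ext y; simp
  have h2 : (LinearMap.ker (f.domRestrict U)).map U.subtype = U ⊓ LinearMap.ker f := by
    ext y; simp; tauto
  rw [h1] at h
  rw [← h, ← h2, LinearEquiv.finrank_eq (Submodule.equivMapOfInjective U.subtype
    U.injective_subtype (LinearMap.ker (f.domRestrict U)))]

/-- Multiplication by `x` on `M`, as a `K`-linear map. -/
def mulx (K : Type*) [Field K] {R : Type*} [CommRing R] [Algebra K R]
    (M : Type*) [AddCommGroup M] [Module R M] [Module K M] [IsScalarTower K R M]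
    (x : R) : M →ₗ[K] M :=
  (LinearMap.lsmul R M x).restrictScalars K

theorem mulx_apply (x : R) (m : M) : mulx K M x m = x • m := rfl

theorem dim_step {x : R} {δ : ℕ} (hx : ∀ (j : ℤ), ∀ m ∈ ℳ j, x • m ∈ ℳ ((δ : ℤ) + j))
    (hfin : ∀ n, FiniteDimensional K (ℳ n))
    (A B : Submodule R M) (hA : Hom' ℳ A) (hB : Hom' ℳ B) (n : ℤ) :
    Module.finrank K (pc ℳ (B.map (LinearMap.lsmul R M x) ⊔ A) (n + δ)) +
      Module.finrank K (pc ℳ (B ⊓ A.comap (LinearMap.lsmul R M x)) n) =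
    Module.finrank K (pc ℳ B n) + Module.finrank K (pc ℳ A (n + δ)) := by
  have hf : ∀ (C : Submodule R M) n, FiniteDimensional K (pc ℳ C n) := fun C n =>
    Submodule.finiteDimensional_of_le (inf_le_right : pc ℳ C n ≤ ℳ n)
  set Q := (A.restrictScalars K).mkQ
  have h1 := finrank_map_add Q (pc ℳ (B.map (LinearMap.lsmul R M x) ⊔ A) (n + δ))
  have h2 := finrank_map_add (Q ∘ₗ mulx K M x) (pc ℳ B n)
  have e1 : pc ℳ (B.map (LinearMap.lsmul R M x) ⊔ A) (n + δ) ⊓ LinearMap.ker Q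
      = pc ℳ A (n + δ) := by
    ext y
    simp only [Q, Submodule.ker_mkQ, Submodule.mem_inf, mem_pc, Submodule.restrictScalars_mem]
    exact ⟨fun h => ⟨h.2, h.1.2⟩, fun h => ⟨⟨Submodule.mem_sup_right h.1, h.2⟩, h.1⟩⟩
  have e2 : pc ℳ B n ⊓ LinearMap.ker (Q ∘ₗ mulx K M x)
      = pc ℳ (B ⊓ A.comap (LinearMap.lsmul R M x)) n := by
    ext y
    simp only [Q, LinearMap.ker_comp, Submodule.ker_mkQ, Submodule.mem_inf, mem_pc,
      Submodule.mem_comap, Submodule.restrictScalars_mem, mulx_apply, LinearMap.lsmul_apply]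
    tauto
  have e3 : (pc ℳ (B.map (LinearMap.lsmul R M x) ⊔ A) (n + δ)).map Q
      = (pc ℳ B n).map (Q ∘ₗ mulx K M x) := by
    apply le_antisymm
    · rintro _ ⟨y, ⟨hy, hyn⟩, rfl⟩
      obtain ⟨_, ⟨b, hb, rfl⟩, a, ha, hab⟩ := Submodule.mem_sup.1 hy
      refine ⟨gp ℳ n b, ⟨hB n b hb, gp_mem ℳ n b⟩, ?_⟩
      have : y = x • gp ℳ n b + gp ℳ (n + δ) a := by
        rw [← gp_same ℳ hyn, ← hab, map_add, ← gp_smul ℳ hx]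
        rfl
      rw [this, map_add]
      have h0 : Q (gp ℳ (n + δ) a) = 0 := by
        simpa [Q] using hA _ _ ha
      rw [h0, add_zero]; rfl
    · rintro _ ⟨b, ⟨hb, hbn⟩, rfl⟩
      refine ⟨x • b, ⟨Submodule.mem_sup_left ⟨b, hb, rfl⟩, ?_⟩, rfl⟩
      rw [add_comm]
      exact hx _ _ hbn
  rw [e1, e3] at h1
  rw [e2] at h2
  omega

theorem hom_sup {x : R} {δ : ℕ} (hx : ∀ (j : ℤ), ∀ m ∈ ℳ j, x • m ∈ ℳ ((δ : ℤ) + j))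
    (A B : Submodule R M) (hA : Hom' ℳ A) (hB : Hom' ℳ B) :
    Hom' ℳ (B.map (LinearMap.lsmul R M x) ⊔ A) := by
  intro n y hy
  obtain ⟨_, ⟨b, hb, rfl⟩, a, ha, rfl⟩ := Submodule.mem_sup.1 hy
  rw [map_add]
  refine add_mem (Submodule.mem_sup_left ⟨gp ℳ (n - δ) b, hB _ _ hb, ?_⟩)
    (Submodule.mem_sup_right (hA _ _ ha))
  have := gp_smul ℳ hx (n - δ) b
  rw [sub_add_cancel] at this
  exact this.symm

theorem hom_inf {x : R} {δ : ℕ} (hx : ∀ (j : ℤ), ∀ m ∈ ℳ j, x • m ∈ ℳ ((δ : ℤ) + j))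
    (A B : Submodule R M) (hA : Hom' ℳ A) (hB : Hom' ℳ B) :
    Hom' ℳ (B ⊓ A.comap (LinearMap.lsmul R M x)) := by
  rintro n b ⟨hb, hb'⟩
  refine ⟨hB _ _ hb, ?_⟩
  show x • gp ℳ n b ∈ A
  rw [← gp_smul ℳ hx]
  exact hA _ _ hb'

theorem base_case {d : ℕ} (r : Fin d → R)
    (hnoeth : IsNoetherian (Algebra.adjoin K (Set.range r)) M)
    (A B : Submodule R M) (hA : Hom' ℳ A) (hAB : A ≤ B)
    (hr : ∀ i, ∀ b ∈ B, r i • b ∈ A) :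
    ∃ N : ℤ, ∀ n, N ≤ n → pc ℳ B n = pc ℳ A n := by
  classical
  obtain ⟨F, hF⟩ := hnoeth.noetherian (B.restrictScalars (Algebra.adjoin K (Set.range r)))
  have hFB : ∀ f ∈ F, f ∈ B := fun f hf => by
    have : f ∈ B.restrictScalars (Algebra.adjoin K (Set.range r)) := by
      rw [← hF]; exact Submodule.subset_span hf
    exact this
  have hs : ∀ s ∈ Algebra.adjoin K (Set.range r), ∃ c : K, ∀ b ∈ B, s • b - c • b ∈ A := by
    intro s hs
    induction hs using Algebra.adjoin_induction with
    | mem s hs =>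
      obtain ⟨i, rfl⟩ := hs
      exact ⟨0, fun b hb => by simpa using hr i b hb⟩
    | algebraMap c => exact ⟨c, fun b hb => by simp⟩
    | add s t _ _ hs ht =>
      obtain ⟨c, hc⟩ := hs
      obtain ⟨e, he⟩ := ht
      refine ⟨c + e, fun b hb => ?_⟩
      have := add_mem (hc b hb) (he b hb)
      rw [add_smul, add_smul]
      convert this using 1
      abel
    | mul s t _ _ hs ht =>
      obtain ⟨c, hc⟩ := hs
      obtain ⟨e, he⟩ := ht
      refine ⟨e * c, fun b hb => ?_⟩
      have := add_mem (A.smul_mem s (he b hb))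
        (A.smul_mem (algebraMap K R e) (hc b hb))
      convert this using 1
      simp only [smul_sub, algebraMap_smul, mul_smul]
      rw [smul_comm s e b]
      abel
  have hle : B.restrictScalars K ≤ Submodule.span K (F : Set M) ⊔ A.restrictScalars K := by
    intro b hb
    have hb' : b ∈ Submodule.span (Algebra.adjoin K (Set.range r)) (F : Set M) := by
      rw [hF]; exact hb
    induction hb' using Submodule.span_induction with
    | mem b hb' => exact Submodule.mem_sup_left (Submodule.subset_span hb')
    | zero => exact zero_mem _
    | add x y hx hy ihx ihy =>
      rw [hF] at hx hy
      exact add_mem (ihx hx) (ihy hy)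
    | smul s x hx ih =>
      rw [hF] at hx
      obtain ⟨c, hc⟩ := hs s s.2
      have h1 : s • x = c • x + ((s : R) • x - c • x) := by
        rw [add_sub_cancel]; rfl
      rw [h1]
      exact add_mem (Submodule.smul_mem _ _ (ih hx)) (Submodule.mem_sup_right (hc x hx))
  choose S hS _ using gp_finite ℳ
  obtain ⟨N, hN⟩ : ∃ N : ℤ, ∀ n ∈ F.biUnion S, n < N := by
    obtain ⟨N, hN⟩ := (F.biUnion S).bddAbove
    exact ⟨N + 1, fun n hn => by have := hN hn; omega⟩
  refine ⟨N, fun n hn => le_antisymm ?_ (inf_le_inf_right _ hAB)⟩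
  rintro b ⟨hb, hbn⟩
  refine ⟨?_, hbn⟩
  obtain ⟨f, hf, a, ha, rfl⟩ := Submodule.mem_sup.1 (hle hb)
  have h0 : gp ℳ n f = 0 := by
    have : Submodule.span K (F : Set M) ≤ LinearMap.ker (gp ℳ n) := by
      rw [Submodule.span_le]
      intro g hg
      refine hS g n fun h => ?_
      have := hN n (Finset.mem_biUnion.2 ⟨g, hg, h⟩)
      omega
    exact this hf
  rw [← gp_same ℳ hbn, map_add, h0, zero_add]
  exact hA _ _ ha

theorem main_ind {d : ℕ} (r : Fin d → R) (δ : Fin d → ℕ) (p : ℕ) (hp : ∀ i, δ i ∣ p)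
    (hnoeth : IsNoetherian (Algebra.adjoin K (Set.range r)) M)
    (hfin : ∀ n, FiniteDimensional K (ℳ n))
    (hx : ∀ i, ∀ (j : ℤ), ∀ m ∈ ℳ j, r i • m ∈ ℳ ((δ i : ℤ) + j))
    (T : Finset (Fin d)) : ∀ (A B : Submodule R M), Hom' ℳ A → Hom' ℳ B → A ≤ B →
    (∀ i, i ∉ T → ∀ b ∈ B, r i • b ∈ A) →
    EvZ p T.card (fun n => (Module.finrank K (pc ℳ B n) : ℤ) - Module.finrank K (pc ℳ A n)) := by
  classical
  induction T using Finset.induction_on with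
  | empty =>
    intro A B hA hB hAB hr
    obtain ⟨N, hN⟩ := base_case ℳ r hnoeth A B hA hAB (fun i => hr i (by simp))
    refine ⟨N, fun n hn => ?_⟩
    show (Module.finrank K (pc ℳ B n) : ℤ) - Module.finrank K (pc ℳ A n) = 0
    rw [hN n hn, sub_self]
  | insert i T hi ih =>
    intro A B hA hB hAB hr
    rw [Finset.card_insert_of_notMem hi]
    have hxA : ∀ y ∈ A, r i • y ∈ A := fun y hy => A.smul_mem _ hy
    have h1 := ih (B.map (LinearMap.lsmul R M (r i)) ⊔ A) B (hom_sup ℳ (hx i) A B hA hB) hB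
      (sup_le (by rintro _ ⟨b, hb, rfl⟩; exact B.smul_mem _ hb) hAB) (by
        intro j hj b hb
        by_cases hji : j = i
        · subst hji
          exact Submodule.mem_sup_left ⟨b, hb, rfl⟩
        · exact Submodule.mem_sup_right (hr j (by simp [hji, hj]) b hb))
    have h2 := ih A (B ⊓ A.comap (LinearMap.lsmul R M (r i))) hA (hom_inf ℳ (hx i) A B hA hB)
      (le_inf hAB (fun y hy => A.smul_mem _ hy)) (by
        rintro j hj b ⟨hb, hb'⟩
        by_cases hji : j = i
        · subst hji
          exact hb'
        · exact hr j (by simp [hji, hj]) b hb)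
    obtain ⟨q, rfl⟩ := hp i
    refine EvZ.step ((h1.shift (δ i)).add h2.neg) fun n => ?_
    have := dim_step ℳ (hx i) hfin A B hA hB n
    push_cast
    omega

theorem bdd_below (𝒜 : ℕ → Submodule K R) [GradedAlgebra 𝒜] [Module.Finite R M]
    (hsmul : ∀ (i : ℕ) (j : ℤ), ∀ r ∈ 𝒜 i, ∀ m ∈ ℳ j, r • m ∈ ℳ ((i : ℤ) + j)) :
    ∃ N : ℤ, ∀ n, n < N → ∀ m ∈ ℳ n, m = 0 := by
  classical
  obtain ⟨F, hF⟩ := Module.Finite.fg_top (R := R) (M := M)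
  choose S hS _ using gp_finite ℳ
  obtain ⟨N, hN⟩ := (F.biUnion S).bddBelow
  have key : ∀ m : M, ∀ n, n < N → gp ℳ n m = 0 := by
    intro m
    have hm : m ∈ Submodule.span R (F : Set M) := by rw [hF]; trivial
    induction hm using Submodule.span_induction with
    | mem m hm =>
      intro n hn
      refine hS m n fun h => ?_
      have := hN (Finset.mem_biUnion.2 ⟨m, hm, h⟩)
      omega
    | zero => simp
    | add x y _ _ hx hy =>
      intro n hn
      rw [map_add, hx n hn, hy n hn, add_zero]
    | smul s x _ ih =>
      induction s using DirectSum.Decomposition.inductionOn 𝒜 with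
      | zero => simp
      | @homogeneous i s =>
        intro n hn
        have := gp_smul ℳ (fun j => hsmul i j s s.2) (n - i) x
        rw [sub_add_cancel] at this
        rw [this, ih _ (by omega), smul_zero]
      | add s t hs ht =>
        intro n hn
        rw [add_smul, map_add, hs n hn, ht n hn, add_zero]
  exact ⟨N, fun n hn m hm => by rw [← gp_same ℳ hm, key m n hn]⟩

theorem exists_gens {d : ℕ} (r : Fin d → R)
    (hsop : FiniteDimensional K (M ⧸ (Ideal.span (Set.range r) • (⊤ : Submodule R M)))) :
    ∃ F : Finset M, ∀ m : M, ∃ f ∈ Submodule.span K (F : Set M), ∃ g : Fin d → M,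
      m = f + ∑ i, r i • g i := by
  classical
  set I := Ideal.span (Set.range r) • (⊤ : Submodule R M)
  have hI : ∀ m ∈ I, ∃ g : Fin d → M, m = ∑ i, r i • g i := by
    intro m hm
    refine Submodule.smul_induction_on hm ?_ ?_
    · intro a ha y _
      obtain ⟨c, rfl⟩ := (Ideal.mem_span_range_iff_exists_fun).1 ha
      refine ⟨fun i => c i • y, ?_⟩
      rw [Finset.sum_smul]
      refine Finset.sum_congr rfl fun i _ => ?_
      rw [mul_comm, mul_smul]
    · rintro _ _ ⟨g, rfl⟩ ⟨g', rfl⟩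
      exact ⟨g + g', by simp [smul_add, Finset.sum_add_distrib]⟩
  obtain ⟨k, s, hs⟩ := Module.Finite.exists_fin (R := K) (M := M ⧸ I)
  choose t ht using fun j => Submodule.Quotient.mk_surjective I (s j)
  let Q : M →ₗ[K] M ⧸ I := (I.mkQ).restrictScalars K
  refine ⟨Finset.univ.image t, fun m => ?_⟩
  have h1 : Q m ∈ (Submodule.span K ((Finset.univ.image t : Finset M) : Set M)).map Q := by
    rw [Submodule.map_span]
    have : Q '' ((Finset.univ.image t : Finset M) : Set M) = Set.range s := by
      ext y
      simp only [Finset.coe_image, Finset.coe_univ, Set.image_univ, Set.mem_image, Set.mem_range]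
      constructor
      · rintro ⟨_, ⟨j, rfl⟩, rfl⟩
        exact ⟨j, (ht j).symm⟩
      · rintro ⟨j, rfl⟩
        exact ⟨_, ⟨j, rfl⟩, ht j⟩
    rw [this, hs]; trivial
  obtain ⟨f, hf, hfm⟩ := h1
  have h2 : m - f ∈ I := (Submodule.Quotient.eq I).1 hfm.symm
  obtain ⟨g, hg⟩ := hI _ h2
  exact ⟨f, hf, g, by rw [← hg]; abel⟩

theorem piece_decomp {d : ℕ} (r : Fin d → R) (δ : Fin d → ℕ)
    (hx : ∀ i, ∀ (j : ℤ), ∀ m ∈ ℳ j, r i • m ∈ ℳ ((δ i : ℤ) + j))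
    (F : Finset M) (hF : ∀ m : M, ∃ f ∈ Submodule.span K (F : Set M), ∃ g : Fin d → M,
      m = f + ∑ i, r i • g i) (n : ℤ) (m : M) (hm : m ∈ ℳ n) :
    ∃ f ∈ Submodule.span K (F : Set M), ∃ g : Fin d → M, (∀ i, g i ∈ ℳ (n - δ i)) ∧
      m = gp ℳ n f + ∑ i, r i • g i := by
  obtain ⟨f, hf, g, hg⟩ := hF m
  refine ⟨f, hf, fun i => gp ℳ (n - δ i) (g i), fun i => gp_mem ℳ _ _, ?_⟩
  have h : gp ℳ n m = gp ℳ n f + ∑ i, gp ℳ n (r i • g i) := by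
    rw [hg, map_add, map_sum]
  rw [gp_same ℳ hm] at h
  rw [h]
  congr 1
  refine Finset.sum_congr rfl fun i _ => ?_
  rw [← gp_smul ℳ (hx i), sub_add_cancel]

theorem fin_pieces {d : ℕ} (r : Fin d → R) (δ : Fin d → ℕ) (hδ : ∀ i, 0 < δ i)
    (hx : ∀ i, ∀ (j : ℤ), ∀ m ∈ ℳ j, r i • m ∈ ℳ ((δ i : ℤ) + j))
    (F : Finset M) (hF : ∀ m : M, ∃ f ∈ Submodule.span K (F : Set M), ∃ g : Fin d → M,
      m = f + ∑ i, r i • g i)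
    (N : ℤ) (hN : ∀ n, n < N → ∀ m ∈ ℳ n, m = 0) (n : ℤ) : FiniteDimensional K (ℳ n) := by
  suffices h : ∀ k : ℕ, ∀ n, n < N + k → FiniteDimensional K (ℳ n) from
    h (n - N + 1).toNat n (by omega)
  intro k
  induction k with
  | zero =>
    intro n hn
    have : ℳ n = ⊥ := (Submodule.eq_bot_iff _).2 (hN n (by simpa using hn))
    rw [this]; infer_instance
  | succ k ih =>
    intro n hn
    have hf : ∀ i, FiniteDimensional K (ℳ (n - δ i)) := fun i => ih _ (by
      have := hδ i
      push_cast at hn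
      omega)
    have : FiniteDimensional K (Submodule.span K (F : Set M)) :=
      FiniteDimensional.span_finset K F
    have hle : ℳ n ≤ (Submodule.span K (F : Set M)).map (gp ℳ n) ⊔
        ⨆ i, (ℳ (n - δ i)).map (mulx K M (r i)) := by
      intro m hm
      obtain ⟨f, hf, g, hg, rfl⟩ := piece_decomp ℳ r δ hx F hF n m hm
      refine add_mem (Submodule.mem_sup_left ⟨f, hf, rfl⟩) (Submodule.mem_sup_right ?_)
      exact sum_mem fun i _ => Submodule.mem_iSup_of_mem i ⟨g i, hg i, rfl⟩
    exact Submodule.finiteDimensional_of_le hle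

theorem noeth {d : ℕ} (r : Fin d → R) (δ : Fin d → ℕ) (hδ : ∀ i, 0 < δ i)
    (hx : ∀ i, ∀ (j : ℤ), ∀ m ∈ ℳ j, r i • m ∈ ℳ ((δ i : ℤ) + j))
    (F : Finset M) (hF : ∀ m : M, ∃ f ∈ Submodule.span K (F : Set M), ∃ g : Fin d → M,
      m = f + ∑ i, r i • g i)
    (N : ℤ) (hN : ∀ n, n < N → ∀ m ∈ ℳ n, m = 0) :
    IsNoetherian (Algebra.adjoin K (Set.range r)) M := by
  classical
  set S := Algebra.adjoin K (Set.range r) with hS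
  have : IsNoetherianRing S :=
    isNoetherianRing_of_fg (Subalgebra.fg_def.2 ⟨Set.range r, Set.finite_range r, rfl⟩)
  choose T hT hT' using gp_finite ℳ
  set G : Finset M := F.biUnion fun f => (T f).image fun n => gp ℳ n f with hG
  set P : Submodule S M := Submodule.span S (G : Set M) with hP
  have hPF : ∀ n, ∀ f ∈ Submodule.span K (F : Set M), gp ℳ n f ∈ P := by
    intro n f hf
    have : Submodule.span K (F : Set M) ≤ (P.restrictScalars K).comap (gp ℳ n) := by
      rw [Submodule.span_le]
      intro f hf
      show gp ℳ n f ∈ P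
      by_cases hn : n ∈ T f
      · apply Submodule.subset_span
        simp only [hG, Finset.coe_biUnion, Set.mem_iUnion]
        exact ⟨f, hf, Finset.mem_coe.2 (Finset.mem_image_of_mem _ hn)⟩
      · rw [hT f n hn]; exact zero_mem _
    exact this hf
  have h : ∀ k : ℕ, ∀ n, n < N + k → ∀ m ∈ ℳ n, m ∈ P := by
    intro k
    induction k with
    | zero =>
      intro n hn m hm
      rw [hN n (by simpa using hn) m hm]; exact zero_mem _
    | succ k ih =>
      intro n hn m hm
      obtain ⟨f, hf, g, hg, rfl⟩ := piece_decomp ℳ r δ hx F hF n m hm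
      refine add_mem (hPF n f hf) (sum_mem fun i _ => ?_)
      have := ih (n - δ i) (by have := hδ i; push_cast at hn; omega) (g i) (hg i)
      exact P.smul_mem (⟨r i, Algebra.subset_adjoin ⟨i, rfl⟩⟩ : S) this
  have htop : P = ⊤ := by
    rw [eq_top_iff]
    intro m _
    rw [← hT' m]
    exact sum_mem fun n _ => h (n - N + 1).toNat n (by omega) _ (gp_mem ℳ n m)
  have : Module.Finite S M := ⟨⟨G, htop⟩⟩
  infer_instance

end Graded

open Module in
/-- If `r₁,…,r_d` is a homogeneous system of parameters for the finitely
generated graded module `M` (d = dim M), then the period `π` of the Hilbert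
quasipolynomial `Q_M` divides `lcm(deg r₁, …, deg r_d)`. -/
theorem stmt11 (K : Type*) [Field K] (R : Type*) [CommRing R] [Algebra K R]
    (𝒜 : ℕ → Submodule K R) [GradedAlgebra 𝒜]
    (hR0 : 𝒜 0 = Submodule.span K {(1 : R)})
    (hfg : Algebra.FiniteType K R)
    (M : Type*) [AddCommGroup M] [Module R M] [Module K M] [IsScalarTower K R M]
    [Module.Finite R M]
    (ℳ : ℤ → Submodule K M) [DirectSum.Decomposition ℳ]
    (hsmul : ∀ (i : ℕ) (j : ℤ), ∀ r ∈ 𝒜 i, ∀ m ∈ ℳ j, r • m ∈ ℳ ((i : ℤ) + j))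
    (d : ℕ) (hd : ringKrullDim (R ⧸ Module.annihilator R M) = d)
    -- a homogeneous system of parameters `r : Fin d → R` of degrees `δ`
    (r : Fin d → R) (δ : Fin d → ℕ) (hδpos : ∀ i, 0 < δ i)
    (hhom : ∀ i, r i ∈ 𝒜 (δ i))
    (hsop : FiniteDimensional K
      (M ⧸ (Ideal.span (Set.range r) • (⊤ : Submodule R M))))
    -- the Hilbert quasipolynomial of `M`, with minimal period `π`
    (u : ℕ) (a : ℕ → ℤ → ℂ) (π : ℕ) (hπ : 0 < π)
    (hper : ∀ i ≤ u, ∀ n : ℤ, a i (n + π) = a i n)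
    (hmin : ∀ π' : ℕ, 0 < π' → (∀ i ≤ u, ∀ n : ℤ, a i (n + π') = a i n) → π ≤ π')
    (hQ : ∃ N : ℤ, ∀ n : ℤ, N ≤ n →
      (finrank K ↥(ℳ n) : ℂ) = ∑ i ∈ Finset.range (u + 1), a i n * (n : ℂ) ^ i) :
    π ∣ Finset.univ.lcm δ := by
  classical
  have hx : ∀ i, ∀ (j : ℤ), ∀ m ∈ ℳ j, r i • m ∈ ℳ ((δ i : ℤ) + j) :=
    fun i j m hm => hsmul (δ i) j (r i) (hhom i) m hm
  obtain ⟨F, hF⟩ := exists_gens (K := K) r hsop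
  obtain ⟨N, hN⟩ := bdd_below ℳ 𝒜 hsmul
  have hfin := fin_pieces ℳ r δ hδpos hx F hF N hN
  have hnoeth := noeth ℳ r δ hδpos hx F hF N hN
  have hpos : 0 < Finset.univ.lcm δ := by
    refine Nat.pos_of_ne_zero fun h => ?_
    obtain ⟨i, _, hi⟩ := Finset.lcm_eq_zero_iff.1 h
    exact (hδpos i).ne' hi
  have hev := main_ind ℳ r δ (Finset.univ.lcm δ) (fun i => Finset.dvd_lcm (Finset.mem_univ i))
    hnoeth hfin hx Finset.univ ⊥ ⊤ (by
      intro n b hb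
      rw [(Submodule.mem_bot R).1 hb, map_zero]; exact zero_mem _)
    (fun _ _ _ => trivial) bot_le (fun i hi => absurd (Finset.mem_univ i) hi)
  have h1 : ∀ n, pc ℳ (⊤ : Submodule R M) n = ℳ n := fun n => by
    ext m; simp [mem_pc]
  have h2 : ∀ n, pc ℳ (⊥ : Submodule R M) n = ⊥ := fun n => by
    ext m; simp only [mem_pc, Submodule.mem_bot]
    exact ⟨fun h => h.1, fun h => ⟨h, h ▸ zero_mem _⟩⟩
  have hev' : EvZ (Finset.univ.lcm δ : ℕ) (Finset.univ : Finset (Fin d)).card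
      (fun n => (finrank K (ℳ n) : ℤ)) := by
    convert hev using 2 with n
    rw [h1, h2, finrank_bot]; simp
  refine min_period_dvd u a π _ hπ hper hmin (period_of_EvZ hev' hpos u a π hπ hper ?_)
  obtain ⟨N', hN'⟩ := hQ
  exact ⟨N', fun n hn => by rw [← hN' n hn]; simp⟩
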